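/- Let M ⊆ ℝ^n be a connected open set, (μ,σ) a smooth SDE on M, Ψ: M → M' ⊆ ℝ^{n−r} a reduction map, and Y_1,…,Y_k reduction vector fields for Ψ such that each (Y_i,C_i,0) is an infinitesimal symmetry of (μ,σ) with ∇Ψ·σ·C_i = 0, and let (μ',σ') be the unique smooth pair on M' with L(Ψ) = μ' ∘ Ψ and ∇Ψ·σ = σ' ∘ Ψ. Let V = (Y,C,τ) be an infinitesimal symmetry of (μ,σ) such that, for every i = 1,…,k, [Y,Y_i] lies in the C^∞(M)-module spanned by Y_1,…,Y_k, Y_i(C) = 0 and Y_i(τ) = 0. If Y': M' → ℝ^{n−r}, C': M' → so(m) and τ': M' → ℝ are smooth maps satisfying ∇Ψ·Y = Y' ∘ Ψ, C = C' ∘ Ψ and τ = τ' ∘ Ψ, then (Y',C',τ') is an infinitesimal symmetry of the reduced SDE (μ',σ'). -/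

import Mathlib

noncomputable section

open scoped BigOperators

/-- Partial derivative `∂_j f` at `x`. -/
def pd {d : ℕ} (f : (Fin d → ℝ) → ℝ) (j : Fin d) (x : Fin d → ℝ) : ℝ :=
  fderiv ℝ f x (Pi.single j 1)

/-- A vector field `Y` applied to a scalar function: `Y(f) = ∑ k Y^k ∂_k f`. -/
def vfApp {d : ℕ} (Y : (Fin d → ℝ) → Fin d → ℝ) (f : (Fin d → ℝ) → ℝ)
    (x : Fin d → ℝ) : ℝ :=
  ∑ k, Y x k * pd f k x

/-- Lie bracket of two vector fields. -/
def vfBracket {d : ℕ} (X Y : (Fin d → ℝ) → Fin d → ℝ) (x : Fin d → ℝ) :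
    Fin d → ℝ :=
  fun i => ∑ k, (X x k * pd (fun y => Y y i) k x - Y x k * pd (fun y => X y i) k x)

/-- The bracket `[H,K]` of a vector field `H` with a matrix-valued map `K`. -/
def mixBracket {d m : ℕ} (H : (Fin d → ℝ) → Fin d → ℝ)
    (K : (Fin d → ℝ) → Fin d → Fin m → ℝ) (x : Fin d → ℝ) : Fin d → Fin m → ℝ :=
  fun i j => ∑ k, (H x k * pd (fun y => K y i j) k x - K x k j * pd (fun y => H y i) k x)

/-- The generator `L` of the SDE `(μ,σ)`. -/
def gen {d m : ℕ} (μ : (Fin d → ℝ) → Fin d → ℝ)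
    (σ : (Fin d → ℝ) → Fin d → Fin m → ℝ)
    (f : (Fin d → ℝ) → ℝ) (x : Fin d → ℝ) : ℝ :=
  (1/2) * ∑ α : Fin m, ∑ i, ∑ j, σ x i α * σ x j α * pd (fun y => pd f j y) i x
    + ∑ i, μ x i * pd f i x

/-- The determining equations: `(Y,C,τ)` is an infinitesimal symmetry of `(μ,σ)` on `M`. -/
def IsSymmetry {d m : ℕ} (M : Set (Fin d → ℝ))
    (μ : (Fin d → ℝ) → Fin d → ℝ) (σ : (Fin d → ℝ) → Fin d → Fin m → ℝ)
    (Y : (Fin d → ℝ) → Fin d → ℝ) (C : (Fin d → ℝ) → Fin m → Fin m → ℝ)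
    (τ : (Fin d → ℝ) → ℝ) : Prop :=
  (∀ x ∈ M, ∀ i α, mixBracket Y σ x i α
      = -(1/2) * τ x * σ x i α - ∑ β, σ x i β * C x β α) ∧
  (∀ x ∈ M, ∀ i,
      vfApp Y (fun y => μ y i) x - gen μ σ (fun y => Y y i) x = - τ x * μ x i)

open scoped ContDiff in
theorem contDiffOn_pd {d : ℕ} {M : Set (Fin d → ℝ)} (hM : IsOpen M) {f : (Fin d → ℝ) → ℝ}
    (hf : ContDiffOn ℝ ∞ f M) (j : Fin d) : ContDiffOn ℝ ∞ (fun y => pd f j y) M :=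
  (hf.fderiv_of_isOpen hM (by simp)).clm_apply contDiffOn_const

theorem pd_congr {d : ℕ} {M : Set (Fin d → ℝ)} (hM : IsOpen M) {f g : (Fin d → ℝ) → ℝ}
    (h : ∀ x ∈ M, f x = g x) {x : Fin d → ℝ} (hx : x ∈ M) (j : Fin d) : pd f j x = pd g j x := by
  have : f =ᶠ[nhds x] g := Filter.eventuallyEq_of_mem (hM.mem_nhds hx) h
  unfold pd
  rw [this.fderiv_eq]

theorem pd_mul {d : ℕ} {f g : (Fin d → ℝ) → ℝ} {x : Fin d → ℝ} (hf : DifferentiableAt ℝ f x)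
    (hg : DifferentiableAt ℝ g x) (j : Fin d) :
    pd (fun y => f y * g y) j x = pd f j x * g x + f x * pd g j x := by
  unfold pd
  rw [fderiv_fun_mul hf hg]
  simp
  ring

theorem pd_add {d : ℕ} {f g : (Fin d → ℝ) → ℝ} {x : Fin d → ℝ} (hf : DifferentiableAt ℝ f x)
    (hg : DifferentiableAt ℝ g x) (j : Fin d) :
    pd (fun y => f y + g y) j x = pd f j x + pd g j x := by
  unfold pd
  rw [fderiv_fun_add hf hg]
  simp

theorem pd_sum {d : ℕ} {ι : Type*} {s : Finset ι} {f : ι → (Fin d → ℝ) → ℝ} {x : Fin d → ℝ}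
    (hf : ∀ i ∈ s, DifferentiableAt ℝ (f i) x) (j : Fin d) :
    pd (fun y => ∑ i ∈ s, f i y) j x = ∑ i ∈ s, pd (f i) j x := by
  unfold pd
  rw [fderiv_fun_sum hf]
  simp

open scoped ContDiff in
theorem ContDiffOn.differentiableAt_of_isOpen {d : ℕ} {M : Set (Fin d → ℝ)} (hM : IsOpen M)
    {f : (Fin d → ℝ) → ℝ} (hf : ContDiffOn ℝ ∞ f M) {x : Fin d → ℝ} (hx : x ∈ M) :
    DifferentiableAt ℝ f x :=
  (hf.contDiffAt (hM.mem_nhds hx)).differentiableAt (by simp)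

open scoped ContDiff in
theorem pd_comm {d : ℕ} {M : Set (Fin d → ℝ)} (hM : IsOpen M) {f : (Fin d → ℝ) → ℝ}
    (hf : ContDiffOn ℝ ∞ f M) {x : Fin d → ℝ} (hx : x ∈ M) (i j : Fin d) :
    pd (fun y => pd f j y) i x = pd (fun y => pd f i y) j x := by
  have hs : IsSymmSndFDerivAt ℝ f x :=
    (hf.contDiffAt (hM.mem_nhds hx)).isSymmSndFDerivAt (by
      rw [minSmoothness_of_isRCLikeNormedField]
      exact WithTop.coe_le_coe.2 le_top)
  have hd : DifferentiableAt ℝ (fderiv ℝ f) x :=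
    ((hf.fderiv_of_isOpen hM (m := ∞) (by simp)).contDiffAt
      (hM.mem_nhds hx)).differentiableAt (by simp)
  have key : ∀ a b : Fin d, pd (fun y => pd f b y) a x
      = fderiv ℝ (fderiv ℝ f) x (Pi.single a 1) (Pi.single b 1) := by
    intro a b
    unfold pd
    rw [fderiv_clm_apply hd (differentiableAt_const _)]
    simp
  rw [key, key, hs.eq]

theorem pd_comp {d e : ℕ} {Ψ : (Fin d → ℝ) → Fin e → ℝ} {g : (Fin e → ℝ) → ℝ} {x : Fin d → ℝ}
    (hΨ : ∀ l, DifferentiableAt ℝ (fun y => Ψ y l) x) (hg : DifferentiableAt ℝ g (Ψ x))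
    (j : Fin d) :
    pd (fun y => g (Ψ y)) j x = ∑ l, pd g l (Ψ x) * pd (fun y => Ψ y l) j x := by
  have hΨ' : DifferentiableAt ℝ Ψ x := differentiableAt_pi.2 hΨ
  unfold pd
  rw [fderiv_fun_comp x hg hΨ', ContinuousLinearMap.comp_apply]
  have hv : fderiv ℝ Ψ x (Pi.single j 1)
      = ∑ l, (fderiv ℝ (fun y => Ψ y l) x (Pi.single j 1)) • (Pi.single l 1 : Fin e → ℝ) := by
    rw [fderiv_pi hΨ]
    ext q
    simp [Finset.sum_apply, Pi.single_apply]
  rw [hv, map_sum]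
  refine Finset.sum_congr rfl fun l _ => ?_
  rw [map_smul, smul_eq_mul, mul_comm]

/-- A vector `v` at `x` acts on `g ∘ Ψ` as its pushforward acts on `g`. -/
theorem sum_mul_pd_comp {d e : ℕ} {Ψ : (Fin d → ℝ) → Fin e → ℝ} {g : (Fin e → ℝ) → ℝ}
    {x : Fin d → ℝ} (hΨ : ∀ l, DifferentiableAt ℝ (fun y => Ψ y l) x)
    (hg : DifferentiableAt ℝ g (Ψ x)) {v : Fin d → ℝ} {w : Fin e → ℝ}
    (hw : ∀ l, ∑ j, pd (fun y => Ψ y l) j x * v j = w l) :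
    ∑ j, v j * pd (fun y => g (Ψ y)) j x = ∑ l, w l * pd g l (Ψ x) := by
  simp_rw [pd_comp hΨ hg, ← hw, Finset.mul_sum, Finset.sum_mul]
  rw [Finset.sum_comm]
  exact Finset.sum_congr rfl fun l _ => Finset.sum_congr rfl fun j _ => by ring

open scoped ContDiff in
theorem pd_pd_comp {d e : ℕ} {M : Set (Fin d → ℝ)} {M' : Set (Fin e → ℝ)} (hM : IsOpen M)
    (hM' : IsOpen M') {Ψ : (Fin d → ℝ) → Fin e → ℝ} {g : (Fin e → ℝ) → ℝ}
    (hΨ : ∀ l, ContDiffOn ℝ ∞ (fun y => Ψ y l) M) (hmaps : Set.MapsTo Ψ M M')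
    (hg : ContDiffOn ℝ ∞ g M') {x : Fin d → ℝ} (hx : x ∈ M) (i j : Fin d) :
    pd (fun y => pd (fun z => g (Ψ z)) j y) i x
      = ∑ l, ((∑ q, pd (fun z => pd g l z) q (Ψ x) * pd (fun y => Ψ y q) i x)
          * pd (fun y => Ψ y l) j x
        + pd g l (Ψ x) * pd (fun y => pd (fun z => Ψ z l) j y) i x) := by
  have hΨd : ∀ y ∈ M, ∀ l, DifferentiableAt ℝ (fun y => Ψ y l) y := fun y hy l =>
    (hΨ l).differentiableAt_of_isOpen hM hy
  have hgd : ∀ l, DifferentiableAt ℝ (fun z => pd g l z) (Ψ x) := fun l =>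
    (contDiffOn_pd hM' hg l).differentiableAt_of_isOpen hM' (hmaps hx)
  have hcd : ∀ l, DifferentiableAt ℝ (fun y => pd g l (Ψ y)) x := fun l =>
    (hgd l).fun_comp' x (differentiableAt_pi.2 (hΨd x hx))
  have hPd : ∀ l, DifferentiableAt ℝ (fun y => pd (fun z => Ψ z l) j y) x := fun l =>
    (contDiffOn_pd hM (hΨ l) j).differentiableAt_of_isOpen hM hx
  rw [pd_congr hM (fun y hy => pd_comp (hΨd y hy)
      (hg.differentiableAt_of_isOpen hM' (hmaps hy)) j) hx,
    pd_sum fun l _ => (hcd l).fun_mul (hPd l)]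
  refine Finset.sum_congr rfl fun l _ => ?_
  rw [pd_mul (hcd l) (hPd l), pd_comp (hΨd x hx) (hgd l)]

theorem sum_sum_mul_pullback {d e : ℕ} (v : Fin d → ℝ) (P : Fin e → Fin d → ℝ)
    (G : Fin e → Fin e → ℝ) :
    ∑ i, ∑ j, v i * v j * ∑ l, (∑ q, G q l * P q i) * P l j
      = ∑ q, ∑ l, (∑ i, P q i * v i) * (∑ j, P l j * v j) * G q l := by
  calc _ = ∑ i, ∑ j, ∑ l, ∑ q, P q i * v i * (P l j * v j) * G q l := by
        refine Finset.sum_congr rfl fun i _ => Finset.sum_congr rfl fun j _ => ?_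
        rw [Finset.mul_sum]
        refine Finset.sum_congr rfl fun l _ => ?_
        rw [Finset.sum_mul, Finset.mul_sum]
        exact Finset.sum_congr rfl fun q _ => by ring
    _ = ∑ l, ∑ q, ∑ i, ∑ j, P q i * v i * (P l j * v j) * G q l := by
        simp_rw [fun i => Finset.sum_comm (s := (Finset.univ : Finset (Fin d)))
          (t := (Finset.univ : Finset (Fin e)))
          (f := fun j l => ∑ q, P q i * v i * (P l j * v j) * G q l)]
        rw [Finset.sum_comm]
        refine Finset.sum_congr rfl fun l _ => ?_
        simp_rw [fun i => Finset.sum_comm (s := (Finset.univ : Finset (Fin d)))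
          (t := (Finset.univ : Finset (Fin e)))
          (f := fun j q => P q i * v i * (P l j * v j) * G q l)]
        rw [Finset.sum_comm]
    _ = _ := by
        rw [Finset.sum_comm]
        refine Finset.sum_congr rfl fun q _ => Finset.sum_congr rfl fun l _ => ?_
        rw [Finset.sum_mul_sum, Finset.sum_mul]
        exact Finset.sum_congr rfl fun i _ => by rw [Finset.sum_mul]

theorem sum_sum_mul_sum_comm {ι κ : Type*} [Fintype ι] [Fintype κ] (c : ι → ι → ℝ) (g : κ → ℝ)
    (P : κ → ι → ι → ℝ) :
    ∑ i, ∑ j, c i j * ∑ l, g l * P l i j = ∑ l, g l * ∑ i, ∑ j, c i j * P l i j := by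
  simp_rw [Finset.mul_sum]
  rw [Finset.sum_comm (s := (Finset.univ : Finset κ))]
  refine Finset.sum_congr rfl fun i _ => ?_
  rw [Finset.sum_comm (s := (Finset.univ : Finset κ))]
  exact Finset.sum_congr rfl fun j _ => Finset.sum_congr rfl fun l _ => by ring

open scoped ContDiff in
/-- The generator is intertwined with that of the projected equation. -/
theorem gen_comp {d e m : ℕ} {M : Set (Fin d → ℝ)} {M' : Set (Fin e → ℝ)} (hM : IsOpen M)
    (hM' : IsOpen M') {Ψ : (Fin d → ℝ) → Fin e → ℝ} {g : (Fin e → ℝ) → ℝ}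
    (hΨ : ∀ l, ContDiffOn ℝ ∞ (fun y => Ψ y l) M) (hmaps : Set.MapsTo Ψ M M')
    (hg : ContDiffOn ℝ ∞ g M') {x : Fin d → ℝ} (hx : x ∈ M)
    {μ : (Fin d → ℝ) → Fin d → ℝ} {σ : (Fin d → ℝ) → Fin d → Fin m → ℝ}
    {μ' : (Fin e → ℝ) → Fin e → ℝ} {σ' : (Fin e → ℝ) → Fin e → Fin m → ℝ}
    (hμ : ∀ i, gen μ σ (fun y => Ψ y i) x = μ' (Ψ x) i)
    (hσ : ∀ i a, ∑ j, pd (fun y => Ψ y i) j x * σ x j a = σ' (Ψ x) i a) :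
    gen μ σ (fun y => g (Ψ y)) x = gen μ' σ' g (Ψ x) := by
  have hΨd : ∀ l, DifferentiableAt ℝ (fun y => Ψ y l) x := fun l =>
    (hΨ l).differentiableAt_of_isOpen hM hx
  have hgd := hg.differentiableAt_of_isOpen hM' (hmaps hx)
  have h2 : ∀ α, ∑ i, ∑ j, σ x i α * σ x j α * pd (fun y => pd (fun z => g (Ψ z)) j y) i x
      = ∑ q, ∑ l, σ' (Ψ x) q α * σ' (Ψ x) l α * pd (fun z => pd g l z) q (Ψ x)
        + ∑ l, pd g l (Ψ x) *
          ∑ i, ∑ j, σ x i α * σ x j α * pd (fun y => pd (fun z => Ψ z l) j y) i x := by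
    intro α
    simp_rw [pd_pd_comp hM hM' hΨ hmaps hg hx, Finset.sum_add_distrib, mul_add,
      Finset.sum_add_distrib]
    rw [sum_sum_mul_pullback (fun i => σ x i α) (fun l i => pd (fun y => Ψ y l) i x)
      (fun q l => pd (fun z => pd g l z) q (Ψ x))]
    simp_rw [hσ]
    congr 1
    exact sum_sum_mul_sum_comm _ _ _
  have h1 : ∑ i, μ x i * pd (fun y => g (Ψ y)) i x
      = ∑ l, pd g l (Ψ x) * ∑ i, μ x i * pd (fun y => Ψ y l) i x := by
    simp_rw [pd_comp hΨd hgd, Finset.mul_sum]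
    rw [Finset.sum_comm]
    exact Finset.sum_congr rfl fun l _ => Finset.sum_congr rfl fun j _ => by ring
  have h3 : ∑ α, ∑ l, pd g l (Ψ x) *
        ∑ i, ∑ j, σ x i α * σ x j α * pd (fun y => pd (fun z => Ψ z l) j y) i x
      = ∑ l, pd g l (Ψ x) *
        ∑ α, ∑ i, ∑ j, σ x i α * σ x j α * pd (fun y => pd (fun z => Ψ z l) j y) i x := by
    simp_rw [Finset.mul_sum]
    rw [Finset.sum_comm]
  conv_rhs => unfold gen
  simp_rw [← hμ]
  unfold gen
  simp_rw [h2]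
  rw [Finset.sum_add_distrib, h1, h3, mul_add, add_assoc]
  congr 1
  rw [Finset.mul_sum, ← Finset.sum_add_distrib]
  exact Finset.sum_congr rfl fun l _ => by ring

open scoped ContDiff in
theorem vfApp_vfApp_sub {d : ℕ} {M : Set (Fin d → ℝ)} (hM : IsOpen M) {f : (Fin d → ℝ) → ℝ}
    (hf : ContDiffOn ℝ ∞ f M) {X W : (Fin d → ℝ) → Fin d → ℝ}
    (hX : ∀ i, ContDiffOn ℝ ∞ (fun y => X y i) M) (hW : ∀ i, ContDiffOn ℝ ∞ (fun y => W y i) M)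
    {x : Fin d → ℝ} (hx : x ∈ M) :
    vfApp X (vfApp W f) x - vfApp W (vfApp X f) x = ∑ i, vfBracket X W x i * pd f i x := by
  have hfd : ∀ i, DifferentiableAt ℝ (fun y => pd f i y) x := fun i =>
    (contDiffOn_pd hM hf i).differentiableAt_of_isOpen hM hx
  have key : ∀ {U V : (Fin d → ℝ) → Fin d → ℝ}, (∀ i, ContDiffOn ℝ ∞ (fun y => V y i) M) →
      vfApp U (vfApp V f) x = ∑ i, ∑ k, (U x k * pd (fun y => V y i) k x * pd f i x
        + U x k * V x i * pd (fun y => pd f i y) k x) := by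
    intro U V hV
    have hVd : ∀ i, DifferentiableAt ℝ (fun y => V y i) x := fun i =>
      (hV i).differentiableAt_of_isOpen hM hx
    rw [Finset.sum_comm]
    unfold vfApp
    refine Finset.sum_congr rfl fun k _ => ?_
    rw [pd_sum fun i _ => (hVd i).fun_mul (hfd i), Finset.mul_sum]
    refine Finset.sum_congr rfl fun i _ => ?_
    rw [pd_mul (hVd i) (hfd i)]
    ring
  have hsw : ∑ i, ∑ k, W x k * X x i * pd (fun y => pd f i y) k x
      = ∑ i, ∑ k, X x k * W x i * pd (fun y => pd f i y) k x := by
    rw [Finset.sum_comm]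
    refine Finset.sum_congr rfl fun i _ => Finset.sum_congr rfl fun k _ => ?_
    rw [pd_comm hM hf hx i k]
    ring
  rw [key hW, key hX]
  simp_rw [vfBracket, Finset.sum_add_distrib, hsw, Finset.sum_mul, sub_mul, Finset.sum_sub_distrib]
  ring

theorem pd_const_mul {d : ℕ} (c : ℝ) {f : (Fin d → ℝ) → ℝ} {x : Fin d → ℝ}
    (hf : DifferentiableAt ℝ f x) (j : Fin d) : pd (fun y => c * f y) j x = c * pd f j x := by
  unfold pd
  rw [fderiv_const_mul hf]
  simp

open scoped ContDiff in
theorem pd_gen {d m : ℕ} {M : Set (Fin d → ℝ)} (hM : IsOpen M)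
    {μ : (Fin d → ℝ) → Fin d → ℝ} {σ : (Fin d → ℝ) → Fin d → Fin m → ℝ} {f : (Fin d → ℝ) → ℝ}
    (hμ : ∀ i, ContDiffOn ℝ ∞ (fun y => μ y i) M)
    (hσ : ∀ i α, ContDiffOn ℝ ∞ (fun y => σ y i α) M) (hf : ContDiffOn ℝ ∞ f M)
    {x : Fin d → ℝ} (hx : x ∈ M) (k : Fin d) :
    pd (gen μ σ f) k x
      = (1/2) * ∑ α, ∑ i, ∑ j,
          ((pd (fun y => σ y i α) k x * σ x j α + σ x i α * pd (fun y => σ y j α) k x)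
              * pd (fun y => pd f j y) i x
            + σ x i α * σ x j α * pd (fun z => pd (fun y => pd f j y) i z) k x)
        + ∑ i, (pd (fun y => μ y i) k x * pd f i x + μ x i * pd (fun y => pd f i y) k x) := by
  have d0 : ∀ i, DifferentiableAt ℝ (fun y => μ y i) x := fun i =>
    (hμ i).differentiableAt_of_isOpen hM hx
  have ds : ∀ i α, DifferentiableAt ℝ (fun y => σ y i α) x := fun i α =>
    (hσ i α).differentiableAt_of_isOpen hM hx
  have d1 : ∀ i, DifferentiableAt ℝ (fun y => pd f i y) x := fun i =>
    (contDiffOn_pd hM hf i).differentiableAt_of_isOpen hM hx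
  have d2 : ∀ i j, DifferentiableAt ℝ (fun z => pd (fun y => pd f j y) i z) x := fun i j =>
    (contDiffOn_pd hM (contDiffOn_pd hM hf j) i).differentiableAt_of_isOpen hM hx
  have e2 : ∀ α i j, DifferentiableAt ℝ
      (fun y => σ y i α * σ y j α * pd (fun y => pd f j y) i y) x := fun α i j =>
    ((ds i α).fun_mul (ds j α)).fun_mul (d2 i j)
  have e1 : ∀ i, DifferentiableAt ℝ (fun y => μ y i * pd f i y) x := fun i =>
    (d0 i).fun_mul (d1 i)
  have s1 : ∀ α i, DifferentiableAt ℝ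
      (fun y => ∑ j, σ y i α * σ y j α * pd (fun y => pd f j y) i y) x := fun α i =>
    .fun_sum fun j _ => e2 α i j
  have s2 : ∀ α, DifferentiableAt ℝ
      (fun y => ∑ i, ∑ j, σ y i α * σ y j α * pd (fun y => pd f j y) i y) x := fun α =>
    .fun_sum fun i _ => s1 α i
  have s3 : DifferentiableAt ℝ
      (fun y => ∑ α, ∑ i, ∑ j, σ y i α * σ y j α * pd (fun y => pd f j y) i y) x :=
    .fun_sum fun α _ => s2 α
  unfold gen
  rw [pd_add (s3.const_mul _) (.fun_sum fun i _ => e1 i), pd_const_mul _ s3,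
    pd_sum fun α _ => s2 α, pd_sum fun i _ => e1 i]
  simp_rw [pd_mul (d0 _) (d1 _)]
  congr 2
  refine Finset.sum_congr rfl fun α _ => ?_
  rw [pd_sum fun i _ => s1 α i]
  refine Finset.sum_congr rfl fun i _ => ?_
  rw [pd_sum fun j _ => e2 α i j]
  refine Finset.sum_congr rfl fun j _ => ?_
  rw [pd_mul ((ds i α).fun_mul (ds j α)) (d2 i j), pd_mul (ds i α) (ds j α)]

open scoped ContDiff in
theorem pd_vfApp {d : ℕ} {M : Set (Fin d → ℝ)} (hM : IsOpen M)
    {Z : (Fin d → ℝ) → Fin d → ℝ} {f : (Fin d → ℝ) → ℝ}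
    (hZ : ∀ i, ContDiffOn ℝ ∞ (fun y => Z y i) M) (hf : ContDiffOn ℝ ∞ f M)
    {x : Fin d → ℝ} (hx : x ∈ M) (j : Fin d) :
    pd (vfApp Z f) j x
      = ∑ k, (pd (fun y => Z y k) j x * pd f k x + Z x k * pd (fun y => pd f k y) j x) := by
  have d0 : ∀ i, DifferentiableAt ℝ (fun y => Z y i) x := fun i =>
    (hZ i).differentiableAt_of_isOpen hM hx
  have d1 : ∀ i, DifferentiableAt ℝ (fun y => pd f i y) x := fun i =>
    (contDiffOn_pd hM hf i).differentiableAt_of_isOpen hM hx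
  unfold vfApp
  rw [pd_sum fun k _ => (d0 k).fun_mul (d1 k)]
  exact Finset.sum_congr rfl fun k _ => pd_mul (d0 k) (d1 k) j

open scoped ContDiff in
theorem pd_pd_vfApp {d : ℕ} {M : Set (Fin d → ℝ)} (hM : IsOpen M)
    {Z : (Fin d → ℝ) → Fin d → ℝ} {f : (Fin d → ℝ) → ℝ}
    (hZ : ∀ i, ContDiffOn ℝ ∞ (fun y => Z y i) M) (hf : ContDiffOn ℝ ∞ f M)
    {x : Fin d → ℝ} (hx : x ∈ M) (i j : Fin d) :
    pd (fun y => pd (vfApp Z f) j y) i x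
      = ∑ k, (pd (fun z => pd (fun y => Z y k) j z) i x * pd f k x
          + pd (fun y => Z y k) j x * pd (fun y => pd f k y) i x
          + (pd (fun y => Z y k) i x * pd (fun y => pd f k y) j x
          + Z x k * pd (fun z => pd (fun y => pd f j y) i z) k x)) := by
  have d0 : ∀ i, DifferentiableAt ℝ (fun y => Z y i) x := fun i =>
    (hZ i).differentiableAt_of_isOpen hM hx
  have d0' : ∀ i j, DifferentiableAt ℝ (fun z => pd (fun y => Z y i) j z) x := fun i j =>
    (contDiffOn_pd hM (hZ i) j).differentiableAt_of_isOpen hM hx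
  have d1 : ∀ i, DifferentiableAt ℝ (fun y => pd f i y) x := fun i =>
    (contDiffOn_pd hM hf i).differentiableAt_of_isOpen hM hx
  have d2 : ∀ i j, DifferentiableAt ℝ (fun z => pd (fun y => pd f j y) i z) x := fun i j =>
    (contDiffOn_pd hM (contDiffOn_pd hM hf j) i).differentiableAt_of_isOpen hM hx
  rw [pd_congr hM (fun y hy => pd_vfApp hM hZ hf hy j) hx,
    pd_sum fun k _ => ((d0' k j).fun_mul (d1 k)).fun_add ((d0 k).fun_mul (d2 j k))]
  refine Finset.sum_congr rfl fun k _ => ?_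
  rw [pd_add ((d0' k j).fun_mul (d1 k)) ((d0 k).fun_mul (d2 j k)), pd_mul (d0' k j) (d1 k),
    pd_mul (d0 k) (d2 j k), pd_comm hM (contDiffOn_pd hM hf j) hx k i,
    pd_congr hM (fun y hy => pd_comm hM hf hy j k) hx]

theorem second_order_commutator {ι : Type*} [Fintype ι] (z v f₁ : ι → ℝ) (dz dv F : ι → ι → ℝ)
    (ddz G : ι → ι → ι → ℝ) (hF : ∀ i j, F i j = F j i) :
    ∑ k, z k * ∑ i, ∑ j, ((dv k i * v j + v i * dv k j) * F i j + v i * v j * G k i j)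
      - ∑ i, ∑ j, v i * v j * ∑ k, (ddz i j k * f₁ k + dz j k * F i k
          + (dz i k * F j k + z k * G k i j))
      = 2 * ∑ i, ∑ j, (∑ k, (z k * dv k i - v k * dz k i)) * v j * F i j
        - ∑ k, f₁ k * ∑ i, ∑ j, v i * v j * ddz i j k := by
  have h1 : ∑ k, z k * ∑ i, ∑ j, dv k i * v j * F i j
      = ∑ i, ∑ j, (∑ k, z k * dv k i) * v j * F i j := by
    simp_rw [Finset.sum_mul, Finset.mul_sum]
    rw [Finset.sum_comm]
    refine Finset.sum_congr rfl fun i _ => ?_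
    rw [Finset.sum_comm]
    exact Finset.sum_congr rfl fun j _ => Finset.sum_congr rfl fun k _ => by ring
  have h2 : ∑ k, z k * ∑ i, ∑ j, v i * dv k j * F i j
      = ∑ k, z k * ∑ i, ∑ j, dv k i * v j * F i j := by
    refine Finset.sum_congr rfl fun k _ => congrArg _ ?_
    rw [Finset.sum_comm]
    exact Finset.sum_congr rfl fun i _ => Finset.sum_congr rfl fun j _ => by rw [hF j i]; ring
  have h3 : ∑ k, z k * ∑ i, ∑ j, v i * v j * G k i j
      = ∑ i, ∑ j, v i * v j * ∑ k, z k * G k i j :=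
    (sum_sum_mul_sum_comm (fun i j => v i * v j) z G).symm
  have h4 : ∑ i, ∑ j, v i * v j * ∑ k, dz i k * F j k
      = ∑ i, ∑ j, (∑ k, v k * dz k i) * v j * F i j := by
    simp_rw [Finset.sum_mul, Finset.mul_sum]
    rw [Finset.sum_comm, Finset.sum_comm (γ := ι) (f := fun i j => ∑ k, v k * dz k i * v j * F i j)]
    refine Finset.sum_congr rfl fun j _ => ?_
    rw [Finset.sum_comm]
    exact Finset.sum_congr rfl fun i _ => Finset.sum_congr rfl fun k _ => by rw [hF j i]; ring
  have h5 : ∑ i, ∑ j, v i * v j * ∑ k, dz j k * F i k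
      = ∑ i, ∑ j, v i * v j * ∑ k, dz i k * F j k := by
    rw [Finset.sum_comm]
    exact Finset.sum_congr rfl fun i _ => Finset.sum_congr rfl fun j _ => by rw [mul_comm (v j)]
  have h6 : ∑ i, ∑ j, v i * v j * ∑ k, ddz i j k * f₁ k
      = ∑ k, f₁ k * ∑ i, ∑ j, v i * v j * ddz i j k := by
    simp_rw [mul_comm (ddz _ _ _)]
    exact sum_sum_mul_sum_comm (fun i j => v i * v j) f₁ fun k i j => ddz i j k
  simp_rw [Finset.sum_sub_distrib, sub_mul, add_mul, Finset.sum_sub_distrib,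
    Finset.sum_add_distrib, mul_add, Finset.sum_add_distrib]
  rw [h1, h2, h1, h3, h5, h4, h6]
  ring

theorem sum_skew_mul_eq_zero {ι κ : Type*} [Fintype ι] [Fintype κ] (s : ι → κ → ℝ)
    (C : κ → κ → ℝ) (F : ι → ι → ℝ) (hC : ∀ a b, C a b = -C b a) (hF : ∀ i j, F i j = F j i) :
    ∑ α, ∑ i, ∑ j, (∑ β, s i β * C β α) * s j α * F i j = 0 := by
  have h1 : ∑ α, ∑ i, ∑ j, (∑ β, s i β * C β α) * s j α * F i j
      = ∑ α, ∑ β, C β α * ∑ i, ∑ j, s j α * s i β * F i j := by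
    refine Finset.sum_congr rfl fun α _ => ?_
    have := sum_sum_mul_sum_comm (fun _ _ => 1) (fun β => C β α)
      fun β i j => s j α * s i β * F i j
    simp_rw [one_mul] at this
    rw [← this]
    refine Finset.sum_congr rfl fun i _ => Finset.sum_congr rfl fun j _ => ?_
    simp_rw [Finset.sum_mul]
    exact Finset.sum_congr rfl fun β _ => by ring
  have h2 : ∑ α, ∑ β, C β α * ∑ i, ∑ j, s j α * s i β * F i j
      = -∑ α, ∑ β, C β α * ∑ i, ∑ j, s j α * s i β * F i j := by
    conv_lhs => rw [Finset.sum_comm]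
    simp_rw [← Finset.sum_neg_distrib]
    refine Finset.sum_congr rfl fun α _ => Finset.sum_congr rfl fun β _ => ?_
    rw [hC α β, neg_mul, Finset.sum_comm]
    refine congrArg _ (congrArg _ ?_)
    exact Finset.sum_congr rfl fun i _ => Finset.sum_congr rfl fun j _ => by rw [hF j i]; ring
  rw [h1]
  linarith

open scoped ContDiff in
/-- An infinitesimal symmetry satisfies the operator identity `[Z, L] = -τ L`. -/
theorem IsSymmetry.vfApp_gen_sub {d m : ℕ} {M : Set (Fin d → ℝ)} (hM : IsOpen M)
    {μ : (Fin d → ℝ) → Fin d → ℝ} {σ : (Fin d → ℝ) → Fin d → Fin m → ℝ}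
    {Z : (Fin d → ℝ) → Fin d → ℝ} {C : (Fin d → ℝ) → Fin m → Fin m → ℝ} {τ : (Fin d → ℝ) → ℝ}
    (h : IsSymmetry M μ σ Z C τ) (hC : ∀ x ∈ M, ∀ a b, C x a b = -C x b a)
    (hμ : ∀ i, ContDiffOn ℝ ∞ (fun y => μ y i) M)
    (hσ : ∀ i α, ContDiffOn ℝ ∞ (fun y => σ y i α) M)
    (hZ : ∀ i, ContDiffOn ℝ ∞ (fun y => Z y i) M)
    {f : (Fin d → ℝ) → ℝ} (hf : ContDiffOn ℝ ∞ f M) {x : Fin d → ℝ} (hx : x ∈ M) :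
    vfApp Z (gen μ σ f) x - gen μ σ (vfApp Z f) x = -τ x * gen μ σ f x := by
  set F : Fin d → Fin d → ℝ := fun i j => pd (fun y => pd f j y) i x with hFdef
  have hF : ∀ i j, F i j = F j i := fun i j => pd_comm hM hf hx i j
  have hbr : ∀ α, ∑ i, ∑ j, mixBracket Z σ x i α * σ x j α * F i j
      = -(1/2) * τ x * ∑ i, ∑ j, σ x i α * σ x j α * F i j
        - ∑ i, ∑ j, (∑ β, σ x i β * C x β α) * σ x j α * F i j := by
    intro α
    simp_rw [h.1 x hx, Finset.mul_sum, ← Finset.sum_sub_distrib]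
    exact Finset.sum_congr rfl fun i _ => Finset.sum_congr rfl fun j _ => by ring
  have hA := fun α => second_order_commutator (Z x) (fun i => σ x i α) (fun k => pd f k x)
    (fun i k => pd (fun y => Z y k) i x) (fun k i => pd (fun y => σ y i α) k x) F
    (fun i j k => pd (fun z => pd (fun y => Z y k) j z) i x)
    (fun k i j => pd (fun z => pd (fun y => pd f j y) i z) k x) hF
  have hB : ∀ α, ∑ i, ∑ j, (∑ k, (Z x k * pd (fun y => σ y i α) k x
        - σ x k α * pd (fun y => Z y i) k x)) * σ x j α * F i j
      = ∑ i, ∑ j, mixBracket Z σ x i α * σ x j α * F i j := fun α => rfl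
  have hskew := sum_skew_mul_eq_zero (σ x) (C x) F (hC x hx) hF
  have hdrift : ∑ k, Z x k * ∑ i, (pd (fun y => μ y i) k x * pd f i x + μ x i * F k i)
      - ∑ i, μ x i * ∑ k, (pd (fun y => Z y k) i x * pd f k x + Z x k * F i k)
      = ∑ i, pd f i x * (vfApp Z (fun y => μ y i) x - ∑ k, μ x k * pd (fun y => Z y i) k x) := by
    have t : ∑ k, ∑ i, Z x k * (μ x i * F k i) = ∑ i, ∑ k, μ x i * (Z x k * F i k) := by
      rw [Finset.sum_comm]
      exact Finset.sum_congr rfl fun i _ => Finset.sum_congr rfl fun k _ => by rw [hF k i]; ring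
    simp_rw [vfApp, mul_sub, Finset.mul_sum, mul_add, Finset.sum_add_distrib,
      Finset.sum_sub_distrib]
    rw [t, Finset.sum_comm (f := fun k i => Z x k * (pd (fun y => μ y i) k x * pd f i x)),
      Finset.sum_comm (f := fun i k => μ x i * (pd (fun y => Z y k) i x * pd f k x)),
      add_sub_add_right_eq_sub]
    congr 1 <;>
    exact Finset.sum_congr rfl fun i _ => Finset.sum_congr rfl fun k _ => by ring
  have hfirst : ∑ i, pd f i x * (vfApp Z (fun y => μ y i) x - ∑ k, μ x k * pd (fun y => Z y i) k x)
      - (1/2) * ∑ α, ∑ k, pd f k x * ∑ i, ∑ j, σ x i α * σ x j α *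
          pd (fun z => pd (fun y => Z y k) j z) i x
      = -τ x * ∑ i, μ x i * pd f i x := by
    rw [Finset.sum_comm, Finset.mul_sum, ← Finset.sum_sub_distrib, Finset.mul_sum]
    refine Finset.sum_congr rfl fun i _ => ?_
    have := h.2 x hx i
    unfold gen at this
    rw [← Finset.mul_sum]
    linear_combination pd f i x * this
  have hL : vfApp Z (gen μ σ f) x
      = (1/2) * ∑ α, ∑ k, Z x k * ∑ i, ∑ j,
          ((pd (fun y => σ y i α) k x * σ x j α + σ x i α * pd (fun y => σ y j α) k x) * F i j
            + σ x i α * σ x j α * pd (fun z => pd (fun y => pd f j y) i z) k x)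
        + ∑ k, Z x k * ∑ i, (pd (fun y => μ y i) k x * pd f i x + μ x i * F k i) := by
    rw [Finset.sum_comm, Finset.mul_sum, ← Finset.sum_add_distrib]
    unfold vfApp
    refine Finset.sum_congr rfl fun k _ => ?_
    rw [pd_gen hM hμ hσ hf hx, ← Finset.mul_sum]
    ring
  have hR : gen μ σ (vfApp Z f) x
      = (1/2) * ∑ α, ∑ i, ∑ j, σ x i α * σ x j α *
          ∑ k, (pd (fun z => pd (fun y => Z y k) j z) i x * pd f k x
            + pd (fun y => Z y k) j x * F i k
            + (pd (fun y => Z y k) i x * F j k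
            + Z x k * pd (fun z => pd (fun y => pd f j y) i z) k x))
        + ∑ i, μ x i * ∑ k, (pd (fun y => Z y k) i x * pd f k x + Z x k * F i k) := by
    unfold gen
    simp_rw [pd_pd_vfApp hM hZ hf hx, pd_vfApp hM hZ hf hx, hFdef]
  have hsum := Finset.sum_congr (rfl : (Finset.univ : Finset (Fin m)) = Finset.univ)
    fun α _ => hA α
  simp_rw [hB, hbr] at hsum
  rw [Finset.sum_sub_distrib, Finset.sum_sub_distrib, ← Finset.mul_sum, Finset.sum_sub_distrib,
    hskew, ← Finset.mul_sum] at hsum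
  rw [hL, hR]
  have hgen : gen μ σ f x = (1/2) * ∑ α, ∑ i, ∑ j, σ x i α * σ x j α * F i j
    + ∑ i, μ x i * pd f i x := rfl
  rw [hgen]
  linear_combination (1/2) * hsum + hdrift + hfirst

theorem gen_congr {d m : ℕ} {M : Set (Fin d → ℝ)} (hM : IsOpen M)
    {μ : (Fin d → ℝ) → Fin d → ℝ} {σ : (Fin d → ℝ) → Fin d → Fin m → ℝ}
    {f g : (Fin d → ℝ) → ℝ} (h : ∀ x ∈ M, f x = g x) {x : Fin d → ℝ} (hx : x ∈ M) :
    gen μ σ f x = gen μ σ g x := by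
  unfold gen
  simp_rw [pd_congr hM h hx, fun j => pd_congr hM (fun y hy => pd_congr hM h hy j) hx]

/-- Theorem 4.3.  In the setting of the reduction theorem, a symmetry
`V = (Y,C,τ)` of `(μ,σ)` with `[Y,Y_i]` in the `C^∞(M)`-module spanned by the `Y_i`,
`Y_i(C) = 0` and `Y_i(τ) = 0` descends to a symmetry `(Y',C',τ')` of the reduced SDE
`(μ',σ')`. -/
theorem reduced_symmetry
    {n p m k r : ℕ} (hrn : r ≤ n) (hp : p = n - r)
    (M : Set (Fin n → ℝ)) (hMopen : IsOpen M) (hMconn : IsConnected M)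
    (μ : (Fin n → ℝ) → Fin n → ℝ) (σ : (Fin n → ℝ) → Fin n → Fin m → ℝ)
    (hμsmooth : ContDiffOn ℝ (⊤ : ℕ∞) μ M) (hσsmooth : ContDiffOn ℝ (⊤ : ℕ∞) σ M)
    (M' : Set (Fin p → ℝ)) (hM'open : IsOpen M')
    (Ψ : (Fin n → ℝ) → Fin p → ℝ)
    (hΨsmooth : ContDiffOn ℝ (⊤ : ℕ∞) Ψ M)
    (hΨim : Ψ '' M = M')
    (hΨsubm : ∀ x ∈ M, Function.Surjective
      (fun v : Fin n → ℝ => (fun i => ∑ j, pd (fun y => Ψ y i) j x * v j : Fin p → ℝ)))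
    (hfib : ∀ y ∈ M', IsConnected {x ∈ M | Ψ x = y})
    (Y : Fin k → (Fin n → ℝ) → Fin n → ℝ)
    (hYsmooth : ∀ i, ContDiffOn ℝ (⊤ : ℕ∞) (Y i) M)
    (hrank : ∀ x ∈ M,
      Module.finrank ℝ (Submodule.span ℝ (Set.range fun i => Y i x)) = r)
    (hintegrable : ∀ i j, ∀ x ∈ M,
      vfBracket (Y i) (Y j) x ∈ Submodule.span ℝ (Set.range fun l => Y l x))
    (hker : ∀ x ∈ M, ∀ v : Fin n → ℝ,
      v ∈ Submodule.span ℝ (Set.range fun i => Y i x) ↔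
        ∀ i, ∑ j, pd (fun y => Ψ y i) j x * v j = 0)
    -- the `(Y_i,C_i,0)` are quasi-strong symmetries of `(μ,σ)` with `∇Ψ·σ·C_i = 0`
    (C : Fin k → (Fin n → ℝ) → Fin m → Fin m → ℝ)
    (hCsmooth : ∀ i, ContDiffOn ℝ (⊤ : ℕ∞) (C i) M)
    (hCso : ∀ i, ∀ x ∈ M, ∀ a b, C i x a b = - C i x b a)
    (hsym : ∀ i, IsSymmetry M μ σ (Y i) (C i) (fun _ => 0))
    (hσC : ∀ i, ∀ x ∈ M, ∀ i₀ : Fin p, ∀ a : Fin m,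
      ∑ b, (∑ j, pd (fun y => Ψ y i₀) j x * σ x j b) * C i x b a = 0)
    -- the reduced SDE `(μ',σ')`
    (μ' : (Fin p → ℝ) → Fin p → ℝ) (σ' : (Fin p → ℝ) → Fin p → Fin m → ℝ)
    (hμ'smooth : ContDiffOn ℝ (⊤ : ℕ∞) μ' M') (hσ'smooth : ContDiffOn ℝ (⊤ : ℕ∞) σ' M')
    (hμ'proj : ∀ x ∈ M, ∀ i, gen μ σ (fun y => Ψ y i) x = μ' (Ψ x) i)
    (hσ'proj : ∀ x ∈ M, ∀ i a, ∑ j, pd (fun y => Ψ y i) j x * σ x j a = σ' (Ψ x) i a)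
    -- the symmetry `V = (Y,C,τ)` of `(μ,σ)`
    (Z : (Fin n → ℝ) → Fin n → ℝ) (Cz : (Fin n → ℝ) → Fin m → Fin m → ℝ)
    (τz : (Fin n → ℝ) → ℝ)
    (hZsmooth : ContDiffOn ℝ (⊤ : ℕ∞) Z M) (hCzsmooth : ContDiffOn ℝ (⊤ : ℕ∞) Cz M)
    (hτzsmooth : ContDiffOn ℝ (⊤ : ℕ∞) τz M)
    (hCzso : ∀ x ∈ M, ∀ a b, Cz x a b = - Cz x b a)
    (hZsym : IsSymmetry M μ σ Z Cz τz)
    (hZbr : ∀ i, ∃ lam : Fin k → (Fin n → ℝ) → ℝ,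
      (∀ j, ContDiffOn ℝ (⊤ : ℕ∞) (lam j) M) ∧
      ∀ x ∈ M, vfBracket Z (Y i) x = ∑ j, lam j x • Y j x)
    (hYiC : ∀ i, ∀ x ∈ M, ∀ a b, vfApp (Y i) (fun y => Cz y a b) x = 0)
    (hYiτ : ∀ i, ∀ x ∈ M, vfApp (Y i) τz x = 0)
    -- the projected data `(Y',C',τ')`
    (Z' : (Fin p → ℝ) → Fin p → ℝ) (Cz' : (Fin p → ℝ) → Fin m → Fin m → ℝ)
    (τz' : (Fin p → ℝ) → ℝ)
    (hZ'smooth : ContDiffOn ℝ (⊤ : ℕ∞) Z' M') (hCz'smooth : ContDiffOn ℝ (⊤ : ℕ∞) Cz' M')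
    (hτz'smooth : ContDiffOn ℝ (⊤ : ℕ∞) τz' M')
    (hZ'proj : ∀ x ∈ M, ∀ i, ∑ j, pd (fun y => Ψ y i) j x * Z x j = Z' (Ψ x) i)
    (hCz'proj : ∀ x ∈ M, ∀ a b, Cz x a b = Cz' (Ψ x) a b)
    (hτz'proj : ∀ x ∈ M, τz x = τz' (Ψ x)) :
    (∀ y ∈ M', ∀ a b, Cz' y a b = - Cz' y b a) ∧
      IsSymmetry M' μ' σ' Z' Cz' τz' := by
  have hΨ : ∀ l, ContDiffOn ℝ (⊤ : ℕ∞) (fun y => Ψ y l) M := contDiffOn_pi.1 hΨsmooth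
  have hμ := contDiffOn_pi.1 hμsmooth
  have hσ : ∀ i α, ContDiffOn ℝ (⊤ : ℕ∞) (fun y => σ y i α) M := fun i =>
    contDiffOn_pi.1 (contDiffOn_pi.1 hσsmooth i)
  have hZ := contDiffOn_pi.1 hZsmooth
  have hμ' := contDiffOn_pi.1 hμ'smooth
  have hσ' : ∀ i α, ContDiffOn ℝ (⊤ : ℕ∞) (fun y => σ' y i α) M' := fun i =>
    contDiffOn_pi.1 (contDiffOn_pi.1 hσ'smooth i)
  have hZ' := contDiffOn_pi.1 hZ'smooth
  have hmaps : Set.MapsTo Ψ M M' := fun x hx => hΨim ▸ Set.mem_image_of_mem Ψ hx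
  have hΨd : ∀ x ∈ M, ∀ l, DifferentiableAt ℝ (fun y => Ψ y l) x := fun x hx l =>
    (hΨ l).differentiableAt_of_isOpen hMopen hx
  have hZΨ : ∀ i, ∀ x ∈ M, Z' (Ψ x) i = vfApp Z (fun y => Ψ y i) x := fun i x hx => by
    rw [← hZ'proj x hx i]
    exact Finset.sum_congr rfl fun j _ => mul_comm _ _
  refine ⟨?_, ?_, ?_⟩
  · rw [← hΨim]
    rintro _ ⟨x, hx, rfl⟩ a b
    rw [← hCz'proj x hx, ← hCz'proj x hx, hCzso x hx]
  · rw [← hΨim]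
    rintro _ ⟨x, hx, rfl⟩ i α
    have hσΨ : ∀ x ∈ M, σ' (Ψ x) i α = vfApp (fun y j => σ y j α) (fun y => Ψ y i) x :=
      fun x hx => by
        rw [← hσ'proj x hx i α]
        exact Finset.sum_congr rfl fun j _ => mul_comm _ _
    have hl : mixBracket Z' σ' (Ψ x) i α
        = ∑ j, mixBracket Z σ x j α * pd (fun y => Ψ y i) j x := by
      have hbr := vfApp_vfApp_sub hMopen (hΨ i) hZ (fun j => hσ j α) hx
      refine Eq.trans ?_ hbr
      unfold mixBracket
      rw [Finset.sum_sub_distrib,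
        ← sum_mul_pd_comp (hΨd x hx)
          ((hσ' i α).differentiableAt_of_isOpen hM'open (hmaps hx)) (hZ'proj x hx),
        ← sum_mul_pd_comp (hΨd x hx)
          ((hZ' i).differentiableAt_of_isOpen hM'open (hmaps hx)) (fun l => hσ'proj x hx l α)]
      simp_rw [pd_congr hMopen hσΨ hx, pd_congr hMopen (hZΨ i) hx]
      rfl
    rw [hl]
    simp_rw [hZsym.1 x hx, ← hσ'proj x hx, ← hτz'proj x hx, ← hCz'proj x hx, sub_mul,
      Finset.sum_sub_distrib, Finset.mul_sum, Finset.sum_mul]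
    congr 1
    · exact Finset.sum_congr rfl fun j _ => by ring
    · rw [Finset.sum_comm]
      exact Finset.sum_congr rfl fun j _ => Finset.sum_congr rfl fun β _ => by ring
  · rw [← hΨim]
    rintro _ ⟨x, hx, rfl⟩ i
    have hcomm := hZsym.vfApp_gen_sub hMopen hCzso hμ hσ hZ (hΨ i) hx
    have h1 : vfApp Z (gen μ σ fun y => Ψ y i) x = vfApp Z' (fun y => μ' y i) (Ψ x) := by
      unfold vfApp
      rw [← sum_mul_pd_comp (hΨd x hx)
        ((hμ' i).differentiableAt_of_isOpen hM'open (hmaps hx)) (hZ'proj x hx)]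
      exact Finset.sum_congr rfl fun j _ => by
        rw [pd_congr hMopen (fun y hy => hμ'proj y hy i) hx]
    have h2 : gen μ σ (vfApp Z fun y => Ψ y i) x = gen μ' σ' (fun y => Z' y i) (Ψ x) := by
      rw [← gen_comp hMopen hM'open hΨ hmaps (hZ' i) hx (hμ'proj x hx) (hσ'proj x hx)]
      exact gen_congr hMopen (fun y hy => (hZΨ i y hy).symm) hx
    rw [← h1, ← h2, hcomm, hμ'proj x hx, hτz'proj x hx]
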